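/- arXiv:1704.01735 — 2 statements merged into one kernel-verified Lean document; each statement's English description precedes it below -/
import Mathlib

section
/- For every ν ∈ {0, 1, …, 12} and every v = (z1,…,z6) ∈ ℂ^6, one has √13 · A0(S·T^ν·v) = A0(v) + ζ^ν A1(v) + ζ^{4ν} A2(v) + ζ^{9ν} A3(v) + ζ^{3ν} A4(v) + ζ^{12ν} A5(v) + ζ^{10ν} A6(v). -/
open Complex Finset

noncomputable section

/-- `ζ = exp(2πi/13)`. -/
def zeta13 : ℂ := Complex.exp (2 * Real.pi * Complex.I / 13)

local notation "ζ" => zeta13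

/-- The diagonal matrix `T = diag(ζ^7, ζ^11, ζ^8, ζ^6, ζ^2, ζ^5)`. -/
def Tmat : Matrix (Fin 6) (Fin 6) ℂ :=
  Matrix.diagonal ![ζ ^ 7, ζ ^ 11, ζ ^ 8, ζ ^ 6, ζ ^ 2, ζ ^ 5]

/-- The matrix `S = -(1/√13)·M`. -/
def Smat : Matrix (Fin 6) (Fin 6) ℂ :=
  (-(1 / (Real.sqrt 13 : ℂ))) • Matrix.of
    ![![ζ^12 - ζ, ζ^10 - ζ^3, ζ^4 - ζ^9, ζ^5 - ζ^8, ζ^2 - ζ^11, ζ^6 - ζ^7],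
      ![ζ^10 - ζ^3, ζ^4 - ζ^9, ζ^12 - ζ, ζ^2 - ζ^11, ζ^6 - ζ^7, ζ^5 - ζ^8],
      ![ζ^4 - ζ^9, ζ^12 - ζ, ζ^10 - ζ^3, ζ^6 - ζ^7, ζ^5 - ζ^8, ζ^2 - ζ^11],
      ![ζ^5 - ζ^8, ζ^2 - ζ^11, ζ^6 - ζ^7, ζ - ζ^12, ζ^3 - ζ^10, ζ^9 - ζ^4],
      ![ζ^2 - ζ^11, ζ^6 - ζ^7, ζ^5 - ζ^8, ζ^3 - ζ^10, ζ^9 - ζ^4, ζ - ζ^12],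
      ![ζ^6 - ζ^7, ζ^5 - ζ^8, ζ^2 - ζ^11, ζ^9 - ζ^4, ζ - ζ^12, ζ^3 - ζ^10]]

/-- The matrix `H`, mapping `(z1,…,z6)` to `(z6, z4, z5, −z3, −z1, −z2)`. -/
def Hmat : Matrix (Fin 6) (Fin 6) ℂ :=
  Matrix.of
    ![![0,0,0,0,0,1], ![0,0,0,1,0,0], ![0,0,0,0,1,0],
      ![0,0,-1,0,0,0], ![-1,0,0,0,0,0], ![0,-1,0,0,0,0]]

/-- The senary quadratic forms `A_0, …, A_6` (here `v 0 = z1, …, v 5 = z6`). -/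
def A : ℕ → (Fin 6 → ℂ) → ℂ
  | 0, v => v 0 * v 3 + v 1 * v 4 + v 2 * v 5
  | 1, v => v 0 ^ 2 - 2 * v 2 * v 3
  | 2, v => -v 4 ^ 2 - 2 * v 1 * v 3
  | 3, v => v 1 ^ 2 - 2 * v 0 * v 4
  | 4, v => v 2 ^ 2 - 2 * v 1 * v 5
  | 5, v => -v 3 ^ 2 - 2 * v 0 * v 5
  | 6, v => -v 5 ^ 2 - 2 * v 2 * v 4
  | _, _ => 0

/-- `w_ν = (A0 + ζ^ν A1 + ζ^{4ν} A2 + ζ^{9ν} A3 + ζ^{3ν} A4 + ζ^{12ν} A5 + ζ^{10ν} A6)^2`. -/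
def w (ν : ℕ) (v : Fin 6 → ℂ) : ℂ :=
  (A 0 v + ζ ^ ν * A 1 v + ζ ^ (4 * ν) * A 2 v + ζ ^ (9 * ν) * A 3 v +
    ζ ^ (3 * ν) * A 4 v + ζ ^ (12 * ν) * A 5 v + ζ ^ (10 * ν) * A 6 v) ^ 2

/-- `w_∞ = 13·A0^2`. -/
def winf (v : Fin 6 → ℂ) : ℂ := 13 * A 0 v ^ 2

/-- The senary cubic forms `D_0, …, D_12` (here `v 0 = z1, …, v 5 = z6`). -/
def D : ℕ → (Fin 6 → ℂ) → ℂ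
  | 0, v => v 0 * v 1 * v 2
  | 1, v => 2 * v 1 * v 2 ^ 2 + v 1 ^ 2 * v 5 - v 3 ^ 2 * v 4 + v 0 * v 4 * v 5
  | 2, v => -v 5 ^ 3 + v 1 ^ 2 * v 3 - 2 * v 1 * v 4 ^ 2 + v 0 * v 3 * v 4 + 3 * v 2 * v 4 * v 5
  | 3, v => 2 * v 0 * v 1 ^ 2 + v 0 ^ 2 * v 4 - v 3 * v 5 ^ 2 + v 2 * v 3 * v 4
  | 4, v => -v 1 ^ 2 * v 2 + v 0 * v 5 ^ 2 - 2 * v 3 ^ 2 * v 5 - v 0 * v 2 * v 4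
  | 5, v => -v 3 ^ 3 + v 2 ^ 2 * v 4 - 2 * v 2 * v 5 ^ 2 + v 1 * v 4 * v 5 + 3 * v 0 * v 3 * v 5
  | 6, v => -v 4 ^ 3 + v 0 ^ 2 * v 5 - 2 * v 0 * v 3 ^ 2 + v 2 * v 3 * v 5 + 3 * v 1 * v 3 * v 4
  | 7, v => -v 1 ^ 3 + v 2 * v 3 ^ 2 - v 0 * v 2 * v 5 - 3 * v 0 * v 1 * v 4 + 2 * v 0 ^ 2 * v 3
  | 8, v => -v 0 ^ 3 + v 1 * v 5 ^ 2 - v 1 * v 2 * v 4 - 3 * v 0 * v 2 * v 3 + 2 * v 2 ^ 2 * v 5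
  | 9, v => 2 * v 0 ^ 2 * v 2 + v 2 ^ 2 * v 3 - v 4 ^ 2 * v 5 + v 1 * v 3 * v 5
  | 10, v => -v 0 * v 2 ^ 2 + v 1 * v 3 ^ 2 - 2 * v 3 * v 4 ^ 2 - v 0 * v 1 * v 5
  | 11, v => -v 2 ^ 3 + v 0 * v 4 ^ 2 - v 0 * v 1 * v 3 - 3 * v 1 * v 2 * v 5 + 2 * v 1 ^ 2 * v 4
  | 12, v => -v 0 ^ 2 * v 1 + v 2 * v 4 ^ 2 - 2 * v 4 * v 5 ^ 2 - v 1 * v 2 * v 3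
  | _, _ => 0

/-- The senary cubic form `D_∞ = z4 z5 z6`. -/
def Dinf (v : Fin 6 → ℂ) : ℂ := v 3 * v 4 * v 5

/-- The senary sextic forms `G_0, …, G_12`. -/
def Gs : ℕ → (Fin 6 → ℂ) → ℂ
  | 0, v => D 0 v ^ 2 + Dinf v ^ 2
  | 1, v => -D 7 v ^ 2 + 2 * D 0 v * D 1 v + 10 * Dinf v * D 1 v + 2 * D 2 v * D 12 v
      - 2 * D 3 v * D 11 v - 4 * D 4 v * D 10 v - 2 * D 9 v * D 5 v
  | 2, v => -2 * D 1 v ^ 2 - 4 * D 0 v * D 2 v + 6 * Dinf v * D 2 v - 2 * D 4 v * D 11 v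
      + 2 * D 5 v * D 10 v - 2 * D 6 v * D 9 v - 2 * D 7 v * D 8 v
  | 3, v => -D 8 v ^ 2 + 2 * D 0 v * D 3 v + 10 * Dinf v * D 3 v + 2 * D 6 v * D 10 v
      - 2 * D 9 v * D 7 v - 4 * D 12 v * D 4 v - 2 * D 1 v * D 2 v
  | 4, v => -D 2 v ^ 2 + 10 * D 0 v * D 4 v - 2 * Dinf v * D 4 v + 2 * D 5 v * D 12 v
      - 2 * D 9 v * D 8 v - 4 * D 1 v * D 3 v - 2 * D 10 v * D 7 v
  | 5, v => -2 * D 9 v ^ 2 - 4 * D 0 v * D 5 v + 6 * Dinf v * D 5 v - 2 * D 10 v * D 8 v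
      + 2 * D 6 v * D 12 v - 2 * D 2 v * D 3 v - 2 * D 11 v * D 7 v
  | 6, v => -2 * D 3 v ^ 2 - 4 * D 0 v * D 6 v + 6 * Dinf v * D 6 v - 2 * D 12 v * D 7 v
      + 2 * D 2 v * D 4 v - 2 * D 5 v * D 1 v - 2 * D 8 v * D 11 v
  | 7, v => -2 * D 10 v ^ 2 + 6 * D 0 v * D 7 v + 4 * Dinf v * D 7 v - 2 * D 1 v * D 6 v
      - 2 * D 2 v * D 5 v - 2 * D 8 v * D 12 v - 2 * D 9 v * D 11 v
  | 8, v => -2 * D 4 v ^ 2 + 6 * D 0 v * D 8 v + 4 * Dinf v * D 8 v - 2 * D 3 v * D 5 v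
      - 2 * D 6 v * D 2 v - 2 * D 11 v * D 10 v - 2 * D 1 v * D 7 v
  | 9, v => -D 11 v ^ 2 + 2 * D 0 v * D 9 v + 10 * Dinf v * D 9 v + 2 * D 5 v * D 4 v
      - 2 * D 1 v * D 8 v - 4 * D 10 v * D 12 v - 2 * D 3 v * D 6 v
  | 10, v => -D 5 v ^ 2 + 10 * D 0 v * D 10 v - 2 * Dinf v * D 10 v + 2 * D 6 v * D 4 v
      - 2 * D 3 v * D 7 v - 4 * D 9 v * D 1 v - 2 * D 12 v * D 11 v
  | 11, v => -2 * D 12 v ^ 2 + 6 * D 0 v * D 11 v + 4 * Dinf v * D 11 v - 2 * D 9 v * D 2 v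
      - 2 * D 5 v * D 6 v - 2 * D 7 v * D 4 v - 2 * D 3 v * D 8 v
  | 12, v => -D 6 v ^ 2 + 10 * D 0 v * D 12 v - 2 * Dinf v * D 12 v + 2 * D 2 v * D 10 v
      - 2 * D 1 v * D 11 v - 4 * D 3 v * D 9 v - 2 * D 4 v * D 8 v
  | _, _ => 0

/-- `δ_ν = −13·G0 + Σ_{j=1}^{12} ζ^{jν} G_j`. -/
def deltaF (ν : ℕ) (v : Fin 6 → ℂ) : ℂ :=
  -13 * Gs 0 v + ∑ j ∈ Finset.Icc 1 12, ζ ^ (j * ν) * Gs j v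

/-- `δ_∞ = 13^2·G0`. -/
def deltaInf (v : Fin 6 → ℂ) : ℂ := 13 ^ 2 * Gs 0 v

/-- `Φ4 = Σ_ν w_ν + w_∞`. -/
def Phi4 (v : Fin 6 → ℂ) : ℂ := (∑ ν ∈ Finset.range 13, w ν v) + winf v

/-- `Φ8 = Σ_ν w_ν^2 + w_∞^2`. -/
def Phi8 (v : Fin 6 → ℂ) : ℂ := (∑ ν ∈ Finset.range 13, w ν v ^ 2) + winf v ^ 2

/-- `Φ12′ = −(1/(13·30))(Σ_ν w_ν^3 + w_∞^3)`. -/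
def Phi12' (v : Fin 6 → ℂ) : ℂ :=
  -(1 / (13 * 30)) * ((∑ ν ∈ Finset.range 13, w ν v ^ 3) + winf v ^ 3)

/-- `Φ16 = Σ_ν w_ν^4 + w_∞^4`. -/
def Phi16 (v : Fin 6 → ℂ) : ℂ := (∑ ν ∈ Finset.range 13, w ν v ^ 4) + winf v ^ 4

/-- `Φ20 = (1/(13·25))(Σ_ν w_ν^5 + w_∞^5)`. -/
def Phi20 (v : Fin 6 → ℂ) : ℂ :=
  (1 / (13 * 25)) * ((∑ ν ∈ Finset.range 13, w ν v ^ 5) + winf v ^ 5)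

/-- `Φ12 = −(1/(13·52))(Σ_ν δ_ν^2 + δ_∞^2)`. -/
def Phi12 (v : Fin 6 → ℂ) : ℂ :=
  -(1 / (13 * 52)) * ((∑ ν ∈ Finset.range 13, deltaF ν v ^ 2) + deltaInf v ^ 2)

/-- `Φ18 = (1/(13·6))(Σ_ν δ_ν^3 + δ_∞^3)`. -/
def Phi18 (v : Fin 6 → ℂ) : ℂ :=
  (1 / (13 * 6)) * ((∑ ν ∈ Finset.range 13, deltaF ν v ^ 3) + deltaInf v ^ 3)

/-- `Φ30 = −(1/(13·1315))(Σ_ν δ_ν^5 + δ_∞^5)`. -/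
def Phi30 (v : Fin 6 → ℂ) : ℂ :=
  -(1 / (13 * 1315)) * ((∑ ν ∈ Finset.range 13, deltaF ν v ^ 5) + deltaInf v ^ 5)

/-- `q^α = exp(2πiαz)`. -/
def qp (α : ℚ) (z : ℂ) : ℂ := Complex.exp (2 * Real.pi * Complex.I * (α : ℂ) * z)

/-- `Σ_{n∈ℤ} (−1)^n q^{(13n^2+cn)/2}`. -/
def thetaSum (c : ℤ) (z : ℂ) : ℂ :=
  ∑' n : ℤ, (-1 : ℂ) ^ n * qp ((13 * (n : ℚ) ^ 2 + (c : ℚ) * (n : ℚ)) / 2) z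

/-- The theta constants of order 13: `a_1, …, a_6`. -/
def thc : ℕ → ℂ → ℂ
  | 1, z => qp (121 / 104) z * thetaSum 11 z
  | 2, z => qp (49 / 104) z * thetaSum 7 z
  | 3, z => qp (25 / 104) z * thetaSum 5 z
  | 4, z => -(qp (9 / 104) z * thetaSum 3 z)
  | 5, z => qp (81 / 104) z * thetaSum 9 z
  | 6, z => qp (1 / 104) z * thetaSum 1 z
  | _, _ => 0

/-- The vector `A(z) = (a1(z), …, a6(z))`. -/
def Avec (z : ℂ) : Fin 6 → ℂ := fun i => thc (i.val + 1) z

/-- The Dedekind eta function `η(z) = q^{1/24} Π_{n=1}^∞ (1−q^n)`. -/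
def etaF (z : ℂ) : ℂ :=
  qp (1 / 24) z * ∏' n : ℕ, (1 - Complex.exp (2 * Real.pi * Complex.I * z) ^ (n + 1))

/-- The vector `(x1(z), …, x6(z))` with `x_i(z) = η(z)·a_i(z)`. -/
def X (z : ℂ) : Fin 6 → ℂ := fun i => etaF z * thc (i.val + 1) z

/-- The discriminant `Δ(z) = η(z)^24`. -/
def Delta (z : ℂ) : ℂ := etaF z ^ 24

/-- The Eisenstein series `E4(z) = (1/2) Σ_{gcd(m,n)=1} (mz+n)^{−4}`. -/
def E4 (z : ℂ) : ℂ :=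
  (1 / 2) * ∑' p : {p : ℤ × ℤ // Int.gcd p.1 p.2 = 1},
    ((p.1.1 : ℂ) * z + (p.1.2 : ℂ)) ^ (-4 : ℤ)

/-- The Eisenstein series `E6(z) = (1/2) Σ_{gcd(m,n)=1} (mz+n)^{−6}`. -/
def E6 (z : ℂ) : ℂ :=
  (1 / 2) * ∑' p : {p : ℤ × ℤ // Int.gcd p.1 p.2 = 1},
    ((p.1.1 : ℂ) * z + (p.1.2 : ℂ)) ^ (-6 : ℤ)

/-- The action of `-√13 • S` on `A 0`, where `z` is a root of the 13th cyclotomic polynomial and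
the quadratic Gauss sum replaces `√13`. -/
lemma A_zero_gauss_transform (z : ℂ) (hz : ∑ k ∈ Finset.range 13, z ^ k = 0) (y : Fin 6 → ℂ) :
    A 0 ((Matrix.of
    ![![z^12 - z, z^10 - z^3, z^4 - z^9, z^5 - z^8, z^2 - z^11, z^6 - z^7],
      ![z^10 - z^3, z^4 - z^9, z^12 - z, z^2 - z^11, z^6 - z^7, z^5 - z^8],
      ![z^4 - z^9, z^12 - z, z^10 - z^3, z^6 - z^7, z^5 - z^8, z^2 - z^11],
      ![z^5 - z^8, z^2 - z^11, z^6 - z^7, z - z^12, z^3 - z^10, z^9 - z^4],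
      ![z^2 - z^11, z^6 - z^7, z^5 - z^8, z^3 - z^10, z^9 - z^4, z - z^12],
      ![z^6 - z^7, z^5 - z^8, z^2 - z^11, z^9 - z^4, z - z^12, z^3 - z^10]]).mulVec y) =
      (1 + 2 * (z + z ^ 3 + z ^ 4 + z ^ 9 + z ^ 10 + z ^ 12)) *
        (A 0 y + A 1 y + A 2 y + A 3 y + A 4 y + A 5 y + A 6 y) := by
  simp only [Finset.sum_range_succ, Finset.sum_range_zero, zero_add, pow_zero, pow_one] at hz
  simp only [A, Matrix.mulVec, dotProduct, Fin.sum_univ_six, Matrix.of_apply, Matrix.cons_val]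
  linear_combination
    ((-1 - z + 2 * z ^ 2 - 2 * z ^ 3 + z ^ 5 + z ^ 7 - z ^ 9) *
        (y 0 ^ 2 + y 1 ^ 2 + y 2 ^ 2 - y 3 ^ 2 - y 4 ^ 2 - y 5 ^ 2) +
      (-z ^ 3 + z ^ 4 + z ^ 6 - 2 * z ^ 7 + z ^ 8 + z ^ 10 - z ^ 11) *
        (y 0 * y 1 + y 0 * y 2 + y 1 * y 2 - y 3 * y 4 - y 3 * y 5 - y 4 * y 5) +
      (-1 - z + z ^ 2 - z ^ 3 + z ^ 4 + z ^ 5 - z ^ 6 + z ^ 7 - z ^ 8 - z ^ 9 + z ^ 10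
        + z ^ 11 - z ^ 12) * (y 0 * y 3 + y 1 * y 4 + y 2 * y 5) +
      (2 + 2 * z - 4 * z ^ 2 + 4 * z ^ 3 - z ^ 4 - 2 * z ^ 5 - z ^ 6 + 2 * z ^ 7 - z ^ 8
        + 2 * z ^ 9 - z ^ 10) *
        (y 0 * y 4 + y 0 * y 5 + y 1 * y 3 + y 1 * y 5 + y 2 * y 3 + y 2 * y 4)) * hz

lemma zeta13_pow_eq_exp (k : ℕ) :
    ζ ^ k = Complex.exp ((2 * Real.pi * k / 13 : ℝ) * Complex.I) := by
  rw [zeta13, ← Complex.exp_nat_mul]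
  congr 1
  push_cast
  ring

lemma isPrimitiveRoot_zeta13 : IsPrimitiveRoot ζ 13 := by
  simpa [zeta13] using Complex.isPrimitiveRoot_exp 13 (by norm_num)

lemma sum_range_zeta13_pow : ∑ k ∈ Finset.range 13, ζ ^ k = 0 :=
  isPrimitiveRoot_zeta13.geom_sum_eq_zero (by norm_num)

lemma zeta13_pow_add_pow (k : ℕ) (hk : k ≤ 13) :
    ζ ^ k + ζ ^ (13 - k) = ((2 * Real.cos (2 * Real.pi * k / 13) : ℝ) : ℂ) := by
  have h : ((2 * Real.pi * (13 - k : ℕ) / 13 : ℝ) : ℂ) * Complex.I =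
      -((2 * Real.pi * k / 13 : ℝ) : ℂ) * Complex.I + 2 * Real.pi * Complex.I := by
    push_cast [Nat.cast_sub hk]
    ring
  rw [zeta13_pow_eq_exp, zeta13_pow_eq_exp, h, Complex.exp_periodic]
  push_cast
  rw [Complex.two_cos]

/-- The quadratic Gauss sum modulo 13, with its sign. -/
lemma sqrt_thirteen_eq_gauss_sum :
    (Real.sqrt 13 : ℂ) = 1 + 2 * (ζ + ζ ^ 3 + ζ ^ 4 + ζ ^ 9 + ζ ^ 10 + ζ ^ 12) := by
  have h1 := zeta13_pow_add_pow 1 (by norm_num)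
  have h3 := zeta13_pow_add_pow 3 (by norm_num)
  have h4 := zeta13_pow_add_pow 4 (by norm_num)
  norm_num only [pow_one, Nat.cast_one, mul_one] at h1 h3 h4
  set g : ℝ := 1 + 4 * (Real.cos (2 * Real.pi / 13) + Real.cos (2 * Real.pi * 3 / 13)
    + Real.cos (2 * Real.pi * 4 / 13)) with hg
  have hg_sum : 1 + 2 * (ζ + ζ ^ 3 + ζ ^ 4 + ζ ^ 9 + ζ ^ 10 + ζ ^ 12) = (g : ℂ) := by
    rw [hg]
    push_cast at h1 h3 h4 ⊢
    linear_combination 2 * h1 + 2 * h3 + 2 * h4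
  have hg_sq : g ^ 2 = 13 := by
    have hz := sum_range_zeta13_pow
    simp only [Finset.sum_range_succ, Finset.sum_range_zero, zero_add, pow_zero, pow_one] at hz
    apply Complex.ofReal_injective
    push_cast
    rw [← hg_sum]
    linear_combination (-12 + 16 * ζ + 8 * ζ ^ 4 - 4 * ζ ^ 5 - 4 * ζ ^ 6 + 4 * ζ ^ 7
      - 4 * ζ ^ 8 + 8 * ζ ^ 10 - 4 * ζ ^ 11 + 4 * ζ ^ 12) * hz
  have hg_nonneg : 0 ≤ g := by
    have hpi := Real.pi_pos
    have hcos1 : 1 / 2 ≤ Real.cos (2 * Real.pi / 13) := by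
      rw [← Real.cos_pi_div_three]
      apply Real.cos_le_cos_of_nonneg_of_le_pi <;> linarith
    have hcos3 : 0 ≤ Real.cos (2 * Real.pi * 3 / 13) := by
      apply Real.cos_nonneg_of_neg_pi_div_two_le_of_le <;> linarith
    have hcos4 : -(1 / 2) ≤ Real.cos (2 * Real.pi * 4 / 13) := by
      rw [← Real.cos_pi_div_three, ← Real.cos_pi_sub]
      apply Real.cos_le_cos_of_nonneg_of_le_pi <;> linarith
    linarith
  rw [hg_sum, ← hg_sq, Real.sqrt_sq hg_nonneg]

/-- `√13 · A0(S·T^ν·v) = A0(v) + ζ^ν A1(v) + ζ^{4ν} A2(v) + ζ^{9ν} A3(v)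
+ ζ^{3ν} A4(v) + ζ^{12ν} A5(v) + ζ^{10ν} A6(v)` for `0 ≤ ν ≤ 12`. -/
theorem stmt_3 (ν : ℕ) (hν : ν ≤ 12) (v : Fin 6 → ℂ) :
    (Real.sqrt 13 : ℂ) * A 0 ((Smat * Tmat ^ ν).mulVec v) =
      A 0 v + ζ ^ ν * A 1 v + ζ ^ (4 * ν) * A 2 v + ζ ^ (9 * ν) * A 3 v +
        ζ ^ (3 * ν) * A 4 v + ζ ^ (12 * ν) * A 5 v + ζ ^ (10 * ν) * A 6 v := by
  have hsqrt : (Real.sqrt 13 : ℂ) ^ 2 = 13 := by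
    norm_cast
    exact Real.sq_sqrt (by norm_num)
  have hsqrt_ne : (Real.sqrt 13 : ℂ) ≠ 0 := by
    intro h
    norm_num [h] at hsqrt
  have hA_smul (c : ℂ) (u : Fin 6 → ℂ) : A 0 (c • u) = c ^ 2 * A 0 u := by
    simp only [A, Pi.smul_apply, smul_eq_mul]
    ring
  have hT : (Tmat ^ ν).mulVec v =
      ![(ζ ^ ν) ^ 7 * v 0, (ζ ^ ν) ^ 11 * v 1, (ζ ^ ν) ^ 8 * v 2, (ζ ^ ν) ^ 6 * v 3,
        (ζ ^ ν) ^ 2 * v 4, (ζ ^ ν) ^ 5 * v 5] := by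
    ext i
    rw [Tmat, Matrix.diagonal_pow, Matrix.mulVec_diagonal]
    fin_cases i <;> simp [← pow_mul, mul_comm ν]
  have hx : (ζ ^ ν) ^ 13 = 1 := by
    rw [← pow_mul, mul_comm, pow_mul, isPrimitiveRoot_zeta13.pow_eq_one, one_pow]
  have hpow (k : ℕ) : ζ ^ (k * ν) = (ζ ^ ν) ^ k := by
    rw [← pow_mul, mul_comm]
  rw [← Matrix.mulVec_mulVec, Smat, Matrix.smul_mulVec, hA_smul,
    A_zero_gauss_transform ζ sum_range_zeta13_pow, ← sqrt_thirteen_eq_gauss_sum, hT]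
  have hscale : (Real.sqrt 13 : ℂ) * (-(1 / (Real.sqrt 13 : ℂ))) ^ 2 * Real.sqrt 13 = 1 := by
    field_simp
  rw [← mul_assoc, ← mul_assoc, hscale, one_mul]
  simp only [hpow, A, Matrix.cons_val]
  generalize ζ ^ ν = x at hx
  linear_combination (v 0 * v 3 + v 1 * v 4 + v 2 * v 5 + x * (v 0 ^ 2 - 2 * v 2 * v 3)
    - 2 * x ^ 4 * v 1 * v 3 + x ^ 9 * v 1 ^ 2 + x ^ 3 * (v 2 ^ 2 - 2 * v 1 * v 5)) * hx

end
end

section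
/- For every v ∈ ℂ^6 one has G0(T·v) = G0(v) and G0(H·v) = G0(v); i.e., the sextic form G0 is invariant under the subgroup of GL(6, ℂ) generated by H and T. -/
open Complex Finset

noncomputable section

local notation "ζ" => zeta13

theorem zeta13_pow_thirteen : ζ ^ 13 = 1 := by
  rw [zeta13, ← Complex.exp_nat_mul, ← Complex.exp_two_pi_mul_I]
  congr 1
  push_cast
  ring

theorem Gs_zero_Tmat_mulVec (v : Fin 6 → ℂ) : Gs 0 (Tmat.mulVec v) = Gs 0 v := by
  simp only [Gs, D, Dinf, Tmat, Matrix.mulVec_diagonal, Matrix.cons_val]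
  linear_combination
    ((ζ ^ 39 + ζ ^ 26 + ζ ^ 13 + 1) * (v 0 * v 1 * v 2) ^ 2 +
      (ζ ^ 13 + 1) * (v 3 * v 4 * v 5) ^ 2) * zeta13_pow_thirteen

theorem Gs_zero_Hmat_mulVec (v : Fin 6 → ℂ) : Gs 0 (Hmat.mulVec v) = Gs 0 v := by
  simp only [Gs, D, Dinf, Hmat, Matrix.mulVec, dotProduct, Fin.sum_univ_six, Matrix.of_apply,
    Matrix.cons_val]
  ring

/-- The linear substitutions preserving a function on `ℂ^n` form a subgroup, so invariance can be
checked on generators. -/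
theorem mulVec_invariant_of_mem_closure {n : Type*} [Fintype n] [DecidableEq n] {α : Type*}
    (f : (n → ℂ) → α) {s : Set (Matrix.GeneralLinearGroup n ℂ)}
    (hs : ∀ g ∈ s, ∀ v, f ((g : Matrix n n ℂ).mulVec v) = f v)
    {g : Matrix.GeneralLinearGroup n ℂ} (hg : g ∈ Subgroup.closure s) (v : n → ℂ) :
    f ((g : Matrix n n ℂ).mulVec v) = f v := by
  induction hg using Subgroup.closure_induction generalizing v with
  | mem g hg => exact hs g hg v
  | one => simp
  | mul g h _ _ ihg ihh => rw [Units.val_mul, ← Matrix.mulVec_mulVec, ihg, ihh]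
  | inv g _ ih => rw [← ih, Matrix.mulVec_mulVec, Units.mul_inv, Matrix.one_mulVec]

/-- `G0(T·v) = G0(v)` and `G0(H·v) = G0(v)`; i.e., `G0` is invariant under the
subgroup of `GL(6,ℂ)` generated by `H` and `T`. -/
theorem stmt_6 :
    (∀ v : Fin 6 → ℂ, Gs 0 (Tmat.mulVec v) = Gs 0 v ∧ Gs 0 (Hmat.mulVec v) = Gs 0 v) ∧
    (∀ UH UT : Matrix.GeneralLinearGroup (Fin 6) ℂ,
      (UH : Matrix (Fin 6) (Fin 6) ℂ) = Hmat → (UT : Matrix (Fin 6) (Fin 6) ℂ) = Tmat →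
      ∀ g ∈ (Subgroup.closure {UH, UT} : Subgroup (Matrix.GeneralLinearGroup (Fin 6) ℂ)),
        ∀ v : Fin 6 → ℂ, Gs 0 ((g : Matrix (Fin 6) (Fin 6) ℂ).mulVec v) = Gs 0 v) := by
  refine ⟨fun v => ⟨Gs_zero_Tmat_mulVec v, Gs_zero_Hmat_mulVec v⟩, fun UH UT hH hT g hg v =>
    mulVec_invariant_of_mem_closure (Gs 0) ?_ hg v⟩
  rintro g (rfl | rfl) v
  · rw [hH, Gs_zero_Hmat_mulVec]
  · rw [hT, Gs_zero_Tmat_mulVec]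

end
end
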